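/- arXiv:2411.08004 — 2 statements merged into one kernel-verified Lean document; each statement's English description precedes it below -/
import Mathlib

section
/- Let R be a semiprime left Goldie ring and let R' be a subring of R containing an essential left ideal of R. Then for each regular element c of R there exists a regular element c' of R such that the product c'c is a regular element of R lying in R' (hence a regular element of R'). -/
/-- A two-sided ideal `I` of a ring is nilpotent if for some `n ≥ 1` every product of
`n` elements of `I` vanishes. -/
def TwoSidedIdeal.IsNilpotentIdeal {R : Type*} [Ring R] (I : TwoSidedIdeal R) : Prop :=
  ∃ n : ℕ, 0 < n ∧ ∀ f : Fin n → R, (∀ i, f i ∈ I) → (List.ofFn f).prod = 0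

/-- A ring is semiprime if it has no nonzero nilpotent two-sided ideal. -/
def IsSemiprimeRing' (R : Type*) [Ring R] : Prop :=
  ∀ I : TwoSidedIdeal R, I.IsNilpotentIdeal → I = ⊥

/-- A ring has finite left uniform dimension if it contains no infinite direct sum of
nonzero left ideals. -/
def HasFiniteLeftUniformDimension (R : Type*) [Ring R] : Prop :=
  ¬ ∃ f : ℕ → Ideal R, (∀ n, f n ≠ ⊥) ∧ iSupIndep f

/-- The left annihilator of a subset `S` of a ring. -/
def leftAnnihilator (R : Type*) [Ring R] (S : Set R) : Set R :=
  {r : R | ∀ s ∈ S, r * s = 0}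

/-- The ascending chain condition on left annihilators. -/
def ACCLeftAnnihilators (R : Type*) [Ring R] : Prop :=
  ∀ f : ℕ → Set R, (∀ n, ∃ S : Set R, f n = leftAnnihilator R S) → Monotone f →
    ∃ N, ∀ n, N ≤ n → f n = f N

/-- A ring is a left Goldie ring if it has finite left uniform dimension and satisfies
the a.c.c. on left annihilators. -/
def IsLeftGoldieRing (R : Type*) [Ring R] : Prop :=
  HasFiniteLeftUniformDimension R ∧ ACCLeftAnnihilators R

/-- A left ideal is essential if it meets every nonzero left ideal nontrivially. -/
def IsEssentialLeftIdeal {R : Type*} [Ring R] (I : Ideal R) : Prop :=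
  ∀ J : Ideal R, J ≠ ⊥ → I ⊓ J ≠ ⊥

/-- A ring endomorphism has large image if its image contains an essential left ideal. -/
def HasLargeImage {R : Type*} [Ring R] (σ : R →+* R) : Prop :=
  ∃ I : Ideal R, IsEssentialLeftIdeal I ∧ (I : Set R) ⊆ Set.range σ

/-- The left uniform dimension of a module, with values in `ℕ∞`: the supremum of the
numbers `k` such that `M` contains a direct sum of `k` nonzero submodules. -/
noncomputable def udim (R : Type*) [Ring R] (M : Type*) [AddCommGroup M] [Module R M] : ℕ∞ :=
  sSup {n : ℕ∞ | ∃ (k : ℕ) (f : Fin k → Submodule R M),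
    n = (k : ℕ∞) ∧ (∀ i, f i ≠ ⊥) ∧ iSupIndep f}

/-- `DevLE α P` means that the deviation of the poset `P` is at most the ordinal `α`:
for every descending chain, all but finitely many of its factor intervals either are
trivial or have deviation at most some ordinal `β < α`. -/
def DevLE (α : Ordinal.{v}) (P : Type u) [Preorder P] : Prop :=
  ∀ f : ℕ → P, (∀ n, f (n + 1) ≤ f n) →
    ∃ N : ℕ, ∀ n, N ≤ n →
      (∀ x y : Set.Icc (f (n + 1)) (f n), x ≤ y → y ≤ x) ∨
      ∃ (β : Ordinal.{v}) (_ : β < α), DevLE β (Set.Icc (f (n + 1)) (f n))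
termination_by α

/-- A module has (Gabriel–Rentschler) Krull dimension if the deviation of its lattice of
submodules is defined, i.e. bounded by some ordinal. -/
def HasKrullDimGR (R : Type u) [Ring R] (M : Type v) [AddCommGroup M] [Module R M] : Prop :=
  ∃ α : Ordinal.{max u v}, DevLE α (Submodule R M)

/-- The Gabriel–Rentschler Krull dimension of a module: the least ordinal bounding the
deviation of its lattice of submodules. -/
noncomputable def krullDimGR (R : Type u) [Ring R] (M : Type v) [AddCommGroup M]
    [Module R M] : Ordinal.{max u v} :=
  sInf {α : Ordinal.{max u v} | DevLE α (Submodule R M)}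

section Ore

variable {R : Type*} [Ring R]

/-- A multiplicative subset: contains `1`, omits `0` and is closed under multiplication. -/
def IsMultSet (S : Set R) : Prop :=
  1 ∈ S ∧ 0 ∉ S ∧ ∀ s ∈ S, ∀ t ∈ S, s * t ∈ S

/-- A left Ore set: a multiplicative set satisfying the left Ore condition. -/
def IsLeftOreSet (S : Set R) : Prop :=
  IsMultSet S ∧ ∀ (r : R), ∀ s ∈ S, ∃ s' ∈ S, ∃ r' : R, s' * r = r' * s

/-- `assL S = { r | s r = 0 for some s ∈ S }`. -/
def assL (S : Set R) : Set R := {r : R | ∃ s ∈ S, s * r = 0}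

/-- A left denominator set: a left Ore set such that `r s = 0` with `s ∈ S` implies
`t r = 0` for some `t ∈ S`. -/
def IsLeftDenominatorSet (S : Set R) : Prop :=
  IsLeftOreSet S ∧ ∀ (r : R), ∀ s ∈ S, r * s = 0 → ∃ t ∈ S, t * r = 0

/-- `θ : R →+* Q` realizes `Q` as the left localization `S⁻¹R` of `R` at `S`:
elements of `S` become units, the kernel of `θ` is `assL S`, and every element of `Q`
has the form `θ(s)⁻¹ θ(r)`. -/
structure IsLeftLocalization {Q : Type*} [Ring Q] (S : Set R) (θ : R →+* Q) : Prop where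
  isUnit : ∀ s ∈ S, IsUnit (θ s)
  ker_eq : ∀ r : R, θ r = 0 ↔ r ∈ assL S
  exists_rep : ∀ q : Q, ∃ s ∈ S, ∃ r : R, θ s * q = θ r

end Ore

section Goldie

variable {R : Type*} [Ring R]

/-- A sequence of submodules is independent if it is dominated by a decreasing sequence `g` such
that each `f n` is disjoint from `g (n + 1)`. -/
theorem iSupIndep_of_le_antitone {M : Type*} [AddCommGroup M] [Module R M]
    {f g : ℕ → Submodule R M} (hg : Antitone g) (hfg : ∀ n, f n ≤ g n)
    (hd : ∀ n, Disjoint (f n) (g (n + 1))) : iSupIndep f := by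
  rw [iSupIndep_iff_finsetSum_eq_zero_imp_eq_zero]
  intro s v hv hsum i
  induction i using Nat.strong_induction_on with
  | _ i ih =>
    intro hi
    refine Submodule.disjoint_def.1 (hd i) _ (hv i hi) ?_
    rw [← s.add_sum_erase _ hi, add_eq_zero_iff_eq_neg] at hsum
    rw [hsum]
    refine Submodule.neg_mem _ (Submodule.sum_mem _ fun j hj => ?_)
    obtain ⟨hji, hj⟩ := Finset.mem_erase.1 hj
    rcases lt_or_gt_of_ne hji with h | h
    · rw [ih j h hj]
      exact Submodule.zero_mem _
    · exact hg h (hfg j (hv j hj))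

theorem HasFiniteLeftUniformDimension.exists_eq_zero (h : HasFiniteLeftUniformDimension R)
    {g : ℕ → Ideal R} (hg : Antitone g) {b : ℕ → R} (hb : ∀ n, b n ∈ g n)
    (hd : ∀ n r, r * b n ∈ g (n + 1) → r * b n = 0) : ∃ n, b n = 0 := by
  by_contra! hne
  refine h ⟨fun n => Ideal.span {b n}, fun n => by simpa using hne n,
    iSupIndep_of_le_antitone hg (fun n => by simpa using hb n) fun n => ?_⟩
  rw [Submodule.disjoint_def]
  intro x hx hxg
  obtain ⟨r, rfl⟩ := Ideal.mem_span_singleton'.1 hx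
  exact hd n r hxg

theorem IsSemiprimeRing'.eq_zero_of_mul_mul (h : IsSemiprimeRing' R) {a : R}
    (ha : ∀ r, a * r * a = 0) : a = 0 := by
  let I : TwoSidedIdeal R := .mk'
    {x | (∀ r, x * r * a = 0) ∧ ∀ y, (∀ r, y * r * a = 0) → y * x = 0}
    ⟨by simp, by simp⟩
    (fun hx hy => ⟨fun r => by simp [add_mul, hx.1, hy.1],
      fun z hz => by simp [mul_add, hx.2 z hz, hy.2 z hz]⟩)
    (fun hx => ⟨fun r => by simp [hx.1], fun z hz => by simp [hx.2 z hz]⟩)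
    (fun {x y} hy => ⟨fun r => by simp [mul_assoc, hy.1],
      fun z hz => by
        rw [← mul_assoc]
        exact hy.2 _ fun r => by rw [mul_assoc z, hz]⟩)
    (fun {x y} hx => ⟨fun r => by rw [mul_assoc x, hx.1],
      fun z hz => by rw [← mul_assoc, hx.2 z hz, zero_mul]⟩)
  have hI : I = ⊥ := by
    refine h I ⟨2, two_pos, fun f hf => ?_⟩
    have h0 := (TwoSidedIdeal.mem_mk' _ _ _ _ _ _ _).1 (hf 0)
    have h1 := (TwoSidedIdeal.mem_mk' _ _ _ _ _ _ _).1 (hf 1)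
    simpa using h1.2 _ h0.1
  have haI : a ∈ I :=
    (TwoSidedIdeal.mem_mk' _ _ _ _ _ _ _).2 ⟨ha, fun y hy => by simpa using hy 1⟩
  rw [hI] at haI
  simpa using haI

/-- Under the ascending chain condition on left annihilators, a nonempty set of elements
has a member whose left annihilator is maximal. -/
theorem ACCLeftAnnihilators.exists_maximal (h : ACCLeftAnnihilators R) {P : R → Prop}
    (hP : ∃ a, P a) :
    ∃ a, P a ∧ ∀ b, P b → (∀ r, r * a = 0 → r * b = 0) → ∀ r, r * b = 0 → r * a = 0 := by
  by_contra! H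
  obtain ⟨a₀, ha₀⟩ := hP
  choose! f hPf hle r hr hr' using H
  have hPn (n : ℕ) : P (f^[n] a₀) := by
    induction n with
    | zero => exact ha₀
    | succ n ih => rw [Function.iterate_succ_apply']; exact hPf _ ih
  obtain ⟨N, hN⟩ := h (fun n => leftAnnihilator R {f^[n] a₀}) (fun n => ⟨_, rfl⟩)
    (monotone_nat_of_le_succ fun n x hx => by
      simp only [leftAnnihilator, Set.mem_singleton_iff, forall_eq, Set.mem_ofPred_eq] at hx ⊢
      rw [Function.iterate_succ_apply']
      exact hle _ (hPn n) x hx)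
  have := Set.ext_iff.1 (hN (N + 1) N.le_succ) (r (f^[N] a₀))
  simp only [leftAnnihilator, Set.mem_singleton_iff, forall_eq, Set.mem_ofPred_eq,
    Function.iterate_succ_apply'] at this
  exact hr' _ (hPn N) (this.1 (hr _ (hPn N)))

/-- The left annihilators of the powers of an element eventually stabilize. -/
theorem ACCLeftAnnihilators.exists_pow_stable (h : ACCLeftAnnihilators R) (x : R) :
    ∃ N, ∀ n, N ≤ n → ∀ r, r * x ^ n = 0 → r * x ^ N = 0 := by
  obtain ⟨N, hN⟩ := h (fun n => leftAnnihilator R {x ^ n}) (fun n => ⟨_, rfl⟩)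
    (monotone_nat_of_le_succ fun n r hr => by
      simp only [leftAnnihilator, Set.mem_singleton_iff, forall_eq, Set.mem_ofPred_eq] at hr ⊢
      rw [pow_succ, ← mul_assoc, hr, zero_mul])
  refine ⟨N, fun n hn r hr => ?_⟩
  have := Set.ext_iff.1 (hN n hn) r
  simp only [leftAnnihilator, Set.mem_singleton_iff, forall_eq, Set.mem_ofPred_eq] at this
  exact this.1 hr

/-- In a semiprime ring with the ascending chain condition on left annihilators, nil left
ideals vanish. -/
theorem IsSemiprimeRing'.eq_bot_of_nil (hs : IsSemiprimeRing' R) (hacc : ACCLeftAnnihilators R)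
    {L : Ideal R} (hL : ∀ x ∈ L, IsNilpotent x) : L = ⊥ := by
  rw [Submodule.eq_bot_iff]
  intro b hb
  by_contra hb0
  obtain ⟨a, ⟨ha0, t, rfl⟩, hmax⟩ := hacc.exists_maximal (P := fun a => a ≠ 0 ∧ ∃ t, a = b * t)
    ⟨b, hb0, 1, by simp⟩
  refine ha0 (hs.eq_zero_of_mul_mul fun x => ?_)
  have hnil : IsNilpotent (b * t * x) := by
    obtain ⟨n, hn⟩ := hL _ (L.mul_mem_left (t * x) hb)
    refine ⟨n + 1, ?_⟩
    rw [mul_assoc b, pow_succ, ← mul_assoc, mul_pow_mul, hn, mul_zero, zero_mul]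
  have key (k : ℕ) (hk : (b * t * x) ^ (k + 1) = 0) : b * t * x * (b * t) = 0 := by
    induction k with
    | zero => rw [zero_add, pow_one] at hk; rw [hk, zero_mul]
    | succ k ih =>
      by_cases h0 : (b * t * x) ^ (k + 1) = 0
      · exact ih h0
      · refine hmax _ ⟨h0, t * x * (b * t * x) ^ k, by rw [pow_succ']; simp only [mul_assoc]⟩
          (fun r hr => ?_) _ (by rw [← pow_succ', hk])
        rw [pow_succ', mul_assoc (b * t), ← mul_assoc, hr, zero_mul]
  obtain ⟨n, hn⟩ := hnil
  exact key n (by rw [pow_succ, hn, zero_mul])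

/-- A nonzero left ideal contains a nonzero element with the same left annihilator as its
square. -/
theorem IsSemiprimeRing'.exists_mem_sq_stable (hs : IsSemiprimeRing' R)
    (hacc : ACCLeftAnnihilators R) {L : Ideal R} (hL : L ≠ ⊥) :
    ∃ a ∈ L, a ≠ 0 ∧ ∀ r, r * (a * a) = 0 → r * a = 0 := by
  obtain ⟨x, hxL, hx⟩ : ∃ x ∈ L, ¬ IsNilpotent x := by
    by_contra! H
    exact hL (hs.eq_bot_of_nil hacc H)
  obtain ⟨N, hN⟩ := hacc.exists_pow_stable x
  refine ⟨x ^ (N + 1), ?_, fun h => hx ⟨_, h⟩, fun r hr => ?_⟩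
  · rw [pow_succ]
    exact L.mul_mem_left _ hxL
  · rw [← pow_add] at hr
    rw [pow_succ, ← mul_assoc, hN _ (by lia) r hr, zero_mul]

/-- The left ideal `{r | r * a ∈ I}` is essential if `I` is. -/
theorem IsEssentialLeftIdeal.comap_mulRight {I : Ideal R} (hI : IsEssentialLeftIdeal I) (a : R) :
    IsEssentialLeftIdeal (Submodule.comap (LinearMap.toSpanSingleton R R a) I) := by
  intro K hK h0
  by_cases hKa : Submodule.map (LinearMap.toSpanSingleton R R a) K = ⊥
  · refine hK (eq_bot_iff.2 (le_trans ?_ h0.le))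
    refine le_inf (fun x hx => ?_) le_rfl
    have : x * a ∈ Submodule.map (LinearMap.toSpanSingleton R R a) K := ⟨x, hx, by simp⟩
    rw [hKa, Submodule.mem_bot] at this
    simp [this]
  · obtain ⟨y, ⟨hyI, k, hk, rfl⟩, hy0⟩ := (Submodule.ne_bot_iff _).1 (hI _ hKa)
    have : k ∈ (⊥ : Ideal R) := h0 ▸ ⟨hyI, hk⟩
    rw [Submodule.mem_bot] at this
    exact hy0 (by simp [this])

/-- The left singular ideal of a semiprime ring with the ascending chain condition on left
annihilators vanishes. -/
theorem IsSemiprimeRing'.eq_zero_of_isEssential_torsionOf (hs : IsSemiprimeRing' R)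
    (hacc : ACCLeftAnnihilators R) {x : R} (hx : IsEssentialLeftIdeal (Ideal.torsionOf R R x)) :
    x = 0 := by
  have hnil (z : R) (hz : IsEssentialLeftIdeal (Ideal.torsionOf R R z)) : IsNilpotent z := by
    obtain ⟨N, hN⟩ := hacc.exists_pow_stable z
    refine ⟨N, ?_⟩
    by_contra h0
    obtain ⟨y, ⟨hy, hy'⟩, hy0⟩ := (Submodule.ne_bot_iff _).1
      (hz (Ideal.span {z ^ N}) (by simpa using h0))
    obtain ⟨r, rfl⟩ := Ideal.mem_span_singleton'.1 hy'
    refine hy0 (hN (N + 1) N.le_succ r ?_)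
    simpa [Ideal.mem_torsionOf_iff, pow_succ, mul_assoc] using hy
  have hspan : Ideal.span {x} = ⊥ := by
    refine hs.eq_bot_of_nil hacc fun y hy => hnil y ?_
    obtain ⟨r, rfl⟩ := Ideal.mem_span_singleton'.1 hy
    convert hx.comap_mulRight r using 1
    ext s
    simp [Ideal.mem_torsionOf_iff, mul_assoc]
  simpa using hspan

/-- An element with zero left annihilator in a ring of finite left uniform dimension generates
an essential left ideal. -/
theorem HasFiniteLeftUniformDimension.isEssential_span_singleton
    (hd : HasFiniteLeftUniformDimension R) {c : R} (hc : ∀ r, r * c = 0 → r = 0) :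
    IsEssentialLeftIdeal (Ideal.span {c}) := by
  intro J hJ h0
  obtain ⟨j, hj, hj0⟩ := (Submodule.ne_bot_iff _).1 hJ
  have hcn (n : ℕ) (r : R) (h : r * c ^ n = 0) : r = 0 := by
    induction n with
    | zero => simpa using h
    | succ n ih => exact ih (hc _ (by rwa [mul_assoc, ← pow_succ]))
  obtain ⟨n, hn⟩ := hd.exists_eq_zero (g := fun n => Ideal.span {c ^ n}) (b := fun n => j * c ^ n)
    (antitone_nat_of_succ_le fun n => by
      rw [Ideal.span_singleton_le_iff_mem, pow_succ']
      exact Ideal.mem_span_singleton'.2 ⟨c, rfl⟩)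
    (fun n => Ideal.mem_span_singleton'.2 ⟨j, rfl⟩)
    (fun n r hr => by
      obtain ⟨s, hs⟩ := Ideal.mem_span_singleton'.1 hr
      have h1 : s * c - r * j = 0 := hcn n _ (by
        rw [sub_mul, mul_assoc, ← pow_succ', hs, mul_assoc, sub_self])
      have h2 : r * j ∈ (⊥ : Ideal R) := h0 ▸
        ⟨Ideal.mem_span_singleton'.2 ⟨s, sub_eq_zero.1 h1⟩, J.mul_mem_left r hj⟩
      rw [← mul_assoc, (Submodule.mem_bot R).1 h2, zero_mul])
  exact hj0 (hcn n j hn)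

/-- In a semiprime left Goldie ring, an element with zero left annihilator is regular. -/
theorem IsSemiprimeRing'.isRegular_of_left_annihilator (hs : IsSemiprimeRing' R)
    (hg : IsLeftGoldieRing R) {c : R} (hc : ∀ r, r * c = 0 → r = 0) : IsRegular c := by
  refine ⟨isLeftRegular_of_non_zero_divisor c fun x hx => ?_,
    isRightRegular_of_non_zero_divisor c hc⟩
  refine hs.eq_zero_of_isEssential_torsionOf hg.2 fun J hJ h0 => ?_
  refine hg.1.isEssential_span_singleton hc J hJ (eq_bot_iff.2 (le_trans ?_ h0.le))
  refine inf_le_inf_right _ ?_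
  simpa [Ideal.span_singleton_le_iff_mem, Ideal.mem_torsionOf_iff] using hx

/-- An essential left ideal of a semiprime left Goldie ring contains a regular element. -/
theorem IsEssentialLeftIdeal.exists_isRegular_mem (hs : IsSemiprimeRing' R)
    (hg : IsLeftGoldieRing R) {I : Ideal R} (hI : IsEssentialLeftIdeal I) :
    ∃ c ∈ I, IsRegular c := by
  by_contra! H
  have step (c : {c : R // c ∈ I ∧ ∀ r, r * (c * c) = 0 → r * c = 0}) :
      ∃ a ∈ I, a ≠ 0 ∧ a * c = 0 ∧ ∀ r, r * (a * a) = 0 → r * a = 0 := by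
    obtain ⟨c, hcI, hc⟩ := c
    have hne : Ideal.torsionOf R R c ≠ ⊥ := fun h0 =>
      H c hcI (hs.isRegular_of_left_annihilator hg fun r hr => by
        have : r ∈ Ideal.torsionOf R R c := (Ideal.mem_torsionOf_iff _ _).2 hr
        rwa [h0] at this)
    obtain ⟨a, ⟨haI, hac⟩, ha0, ha⟩ := hs.exists_mem_sq_stable hg.2 (hI _ hne)
    exact ⟨a, haI, ha0, (Ideal.mem_torsionOf_iff _ _).1 hac, ha⟩
  choose a haI ha0 hac ha using step
  have hann (c) (r : R) (h : r * (c.1 + a c) = 0) : r * c = 0 ∧ r * a c = 0 := by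
    have h1 : r * c.1 = 0 := c.2.2 r <| by
      simpa [mul_add, add_mul, mul_assoc, hac] using congrArg (· * c.1) h
    rw [mul_add, h1, zero_add] at h
    exact ⟨h1, h⟩
  let next (c : {c : R // c ∈ I ∧ ∀ r, r * (c * c) = 0 → r * c = 0}) :
      {c : R // c ∈ I ∧ ∀ r, r * (c * c) = 0 → r * c = 0} :=
    ⟨c.1 + a c, I.add_mem c.2.1 (haI c), fun r hr => by
      rw [← mul_assoc] at hr
      obtain ⟨h1, h2⟩ := hann c _ hr
      have h3 : r * c.1 = 0 := c.2.2 r <| by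
        simpa [mul_add, add_mul, mul_assoc, hac] using h1
      have h4 : r * a c = 0 := ha c r <| by
        simpa [mul_add, add_mul, h3, mul_assoc] using h2
      rw [mul_add, h3, h4, add_zero]⟩
  let s (n : ℕ) := next^[n] ⟨0, I.zero_mem, by simp⟩
  have hs_succ (n : ℕ) : (s (n + 1)).1 = (s n).1 + a (s n) := by
    simp only [s, Function.iterate_succ_apply', next]
  obtain ⟨n, hn⟩ := hg.1.exists_eq_zero (g := fun n => Ideal.torsionOf R R (s n).1)
    (b := fun n => a (s n))
    (antitone_nat_of_succ_le fun n r hr => by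
      rw [Ideal.mem_torsionOf_iff, smul_eq_mul, hs_succ] at hr
      exact (Ideal.mem_torsionOf_iff _ _).2 (hann _ r hr).1)
    (fun n => (Ideal.mem_torsionOf_iff _ _).2 (hac _))
    (fun n r hr => by
      rw [Ideal.mem_torsionOf_iff, smul_eq_mul, hs_succ] at hr
      exact ha _ r (by simpa [mul_assoc] using (hann _ _ hr).2))
  exact ha0 _ hn

end Goldie

/-- **Theorem 2.4.(2).** If `R'` is a subring of a semiprime left Goldie ring `R`
containing an essential left ideal of `R`, then every regular element `c` of `R` admits
a regular element `c'` of `R` with `c' * c` a regular element of `R` lying in `R'`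
(hence a regular element of `R'`). -/
theorem exists_left_multiple_regular_in_large_subring {R : Type*} [Ring R]
    (hsemiprime : IsSemiprimeRing' R) (hgoldie : IsLeftGoldieRing R)
    (R' : Subring R)
    (hlarge : ∃ I : Ideal R, IsEssentialLeftIdeal I ∧ (I : Set R) ⊆ (R' : Set R)) :
    ∀ c : R, IsRegular c → ∃ c' : R, IsRegular c' ∧ c' * c ∈ R' ∧ IsRegular (c' * c) ∧
      ∀ x : R', (x : R) = c' * c → IsRegular x := by
  obtain ⟨I, hI, hIR⟩ := hlarge
  intro c hc
  obtain ⟨c', hc'I, hc'⟩ :=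
    (hI.comap_mulRight c).exists_isRegular_mem hsemiprime hgoldie
  have hreg : IsRegular (c' * c) := hc'.mul hc
  refine ⟨c', hc', hIR hc'I, hreg, fun x hx => ?_⟩
  rw [← hx] at hreg
  exact ⟨fun y z h => Subtype.ext (hreg.left (congrArg Subtype.val h)),
    fun y z h => Subtype.ext (hreg.right (congrArg Subtype.val h))⟩
end

section
/- Let R be a semiprime left Goldie ring and let R' be a subring of R containing an essential left ideal of R. Then the classical left quotient ring of R' exists and Q_l(R') = C_{R'}⁻¹R' = C_{R'}⁻¹R = Q_l(R), where C_{R'} is the set of regular elements of R'. -/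
/-- In a semiprime ring, `z R z = 0` forces `z = 0`. -/
theorem IsSemiprimeRing'.eq_zero_of_forall_mul_mul_eq_zero {R : Type*} [Ring R]
    (h : IsSemiprimeRing' R) {z : R} (hz : ∀ r, z * r * z = 0) : z = 0 := by
  let J : TwoSidedIdeal R := TwoSidedIdeal.mk'
    {x | (∀ r, x * r * z = 0) ∧ ∀ a, (∀ r, a * r * z = 0) → a * x = 0}
    (by simp)
    (fun hx hy => ⟨fun r => by simp [add_mul, hx.1, hy.1],
      fun a ha => by simp [mul_add, hx.2 a ha, hy.2 a ha]⟩)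
    (fun hx => ⟨fun r => by simp [hx.1], fun a ha => by simp [hx.2 a ha]⟩)
    (fun {x y} hy => ⟨fun r => by simp only [mul_assoc] at hy ⊢; simp [hy.1],
      fun a ha => by
        rw [← mul_assoc]
        exact hy.2 _ fun r => by simpa only [mul_assoc] using ha (x * r)⟩)
    (fun {x y} hx => ⟨fun r => by simpa only [mul_assoc] using hx.1 (y * r),
      fun a ha => by rw [← mul_assoc, hx.2 a ha, zero_mul]⟩)
  have hJ : J.IsNilpotentIdeal := by
    refine ⟨2, two_pos, fun f hf => ?_⟩
    have h0 := hf 0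
    have h1 := hf 1
    simp only [J, TwoSidedIdeal.mem_mk'] at h0 h1
    simpa using h1.2 _ h0.1
  have hzJ : z ∈ J := by
    simp only [J, TwoSidedIdeal.mem_mk']
    exact ⟨hz, fun a ha => by simpa using ha 1⟩
  rwa [h J hJ, TwoSidedIdeal.mem_bot] at hzJ

/-- Under the a.c.c. on left annihilators, a nonempty set has an element whose left
annihilator is maximal. -/
theorem ACCLeftAnnihilators.exists_maximal_s12 {R : Type*} [Ring R] (h : ACCLeftAnnihilators R)
    {S : Set R} (hS : S.Nonempty) :
    ∃ a ∈ S, ∀ b ∈ S, (∀ x, x * a = 0 → x * b = 0) → ∀ x, x * b = 0 → x * a = 0 := by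
  have : WellFoundedGT {A : Set R // ∃ S : Set R, A = leftAnnihilator R S} := by
    rw [wellFoundedGT_iff_monotone_chain_condition]
    intro a
    obtain ⟨N, hN⟩ := h (fun n => (a n).1) (fun n => (a n).2) fun _ _ hmn => a.monotone hmn
    exact ⟨N, fun m hm => Subtype.ext (hN m hm).symm⟩
  let l (a : R) : {A : Set R // ∃ S : Set R, A = leftAnnihilator R S} := ⟨_, {a}, rfl⟩
  have hl (a x : R) : x ∈ (l a).1 ↔ x * a = 0 := by simp [l, leftAnnihilator]
  obtain ⟨_, ⟨a, ha, rfl⟩, hmax⟩ :=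
    (wellFounded_gt (α := {A : Set R // ∃ S : Set R, A = leftAnnihilator R S})).has_min
      (l '' S) (hS.image l)
  refine ⟨a, ha, fun b hb hab x hx => ?_⟩
  have hle : l a ≤ l b := fun y hy => (hl b y).2 (hab y ((hl a y).1 hy))
  have heq : l a = l b := hle.eq_of_not_lt (hmax _ ⟨b, hb, rfl⟩)
  rw [← hl, heq, hl]
  exact hx

/-- An essential left ideal contains a nonzero left multiple of each nonzero element. -/
theorem IsEssentialLeftIdeal.exists_mul_mem {R : Type*} [Ring R] {I : Ideal R}
    (hI : IsEssentialLeftIdeal I) {x : R} (hx : x ≠ 0) : ∃ r, r * x ∈ I ∧ r * x ≠ 0 := by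
  have h := hI (Ideal.span {x}) (by simpa using hx)
  obtain ⟨y, hy, hy0⟩ := Submodule.exists_mem_ne_zero_of_ne_bot h
  obtain ⟨r, rfl⟩ := Ideal.mem_span_singleton'.1 hy.2
  exact ⟨r, hy.1, hy0⟩

theorem isEssentialLeftIdeal_of_exists_mul_mem {R : Type*} [Ring R] {I : Ideal R}
    (h : ∀ x : R, x ≠ 0 → ∃ r, r * x ∈ I ∧ r * x ≠ 0) : IsEssentialLeftIdeal I := by
  intro J hJ hIJ
  obtain ⟨j, hj, hj0⟩ := Submodule.exists_mem_ne_zero_of_ne_bot hJ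
  obtain ⟨r, hr, hr0⟩ := h j hj0
  exact hr0 ((Submodule.mem_bot R).1 (hIJ ▸ ⟨hr, J.mul_mem_left r hj⟩))

/-- The left singular ideal of a semiprime ring with a.c.c. on left annihilators is zero. -/
theorem eq_zero_of_isEssentialLeftIdeal_torsionOf {R : Type*} [Ring R]
    (hsemiprime : IsSemiprimeRing' R) (hacc : ACCLeftAnnihilators R) {z : R}
    (hz : IsEssentialLeftIdeal (Ideal.torsionOf R R z)) : z = 0 := by
  by_contra hz0
  obtain ⟨a, ⟨ha, ha0⟩, hmax⟩ := hacc.exists_maximal_s12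
    (S := {z | IsEssentialLeftIdeal (Ideal.torsionOf R R z) ∧ z ≠ 0}) ⟨z, hz, hz0⟩
  have hmul (r : R) : IsEssentialLeftIdeal (Ideal.torsionOf R R (r * a)) := by
    refine isEssentialLeftIdeal_of_exists_mul_mem fun x hx => ?_
    by_cases hxr : x * r = 0
    · exact ⟨1, by simp [← mul_assoc, hxr], by simpa using hx⟩
    · obtain ⟨y, hy, hy0⟩ := ha.exists_mul_mem hxr
      refine ⟨y, by simpa [mul_assoc] using hy, fun h => hy0 ?_⟩
      rw [← mul_assoc, h, zero_mul]
  refine ha0 (hsemiprime.eq_zero_of_forall_mul_mul_eq_zero fun r => ?_)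
  by_contra hr
  obtain ⟨y, hy, hy0⟩ := (hmul r).exists_mul_mem ha0
  refine hy0 (hmax (a * r * a) ⟨hmul _, hr⟩ (fun x hx => ?_) y ?_)
  · simp [← mul_assoc, hx]
  · simpa [mul_assoc] using hy

/-- A sequence of submodules is independent if it is subordinate to a descending chain. -/
theorem iSupIndep_of_antitone_of_disjoint {R M : Type*} [Ring R] [AddCommGroup M] [Module R M]
    {f T : ℕ → Submodule R M} (hT : Antitone T) (hf : ∀ n, f n ≤ T n)
    (hd : ∀ n, Disjoint (f n) (T (n + 1))) : iSupIndep f := by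
  classical
  rw [iSupIndep_iff_finsetSum_eq_zero_imp_eq_zero]
  intro s v hv hsum i hi
  by_contra hne
  have hex : ∃ i, i ∈ s ∧ (v i : M) ≠ 0 := ⟨i, hi, hne⟩
  obtain ⟨hks, hk0⟩ := Nat.find_spec hex
  set k := Nat.find hex
  refine hk0 (Submodule.disjoint_def.1 (hd k) _ (hv k hks) ?_)
  rw [← Finset.add_sum_erase s _ hks] at hsum
  rw [eq_neg_of_add_eq_zero_left hsum]
  refine neg_mem (sum_mem fun j hj => ?_)
  obtain ⟨hjk, hjs⟩ := Finset.mem_erase.1 hj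
  rcases lt_or_gt_of_ne hjk with hlt | hgt
  · have := Nat.find_min hex hlt
    push Not at this
    simp [this hjs]
  · exact hT hgt (hf j (hv j hjs))

/-- In a ring of finite left uniform dimension, an element with zero left annihilator
generates an essential left ideal. -/
theorem HasFiniteLeftUniformDimension.isEssentialLeftIdeal_span_singleton {R : Type*} [Ring R]
    (h : HasFiniteLeftUniformDimension R) {a : R} (ha : ∀ x, x * a = 0 → x = 0) :
    IsEssentialLeftIdeal (Ideal.span {a}) := by
  intro J hJ hdisj
  have hpow (n : ℕ) : ∀ x, x * a ^ n = 0 → x = 0 := by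
    induction n with
    | zero => simp
    | succ n ih => exact fun x hx => ih x (ha _ (by rwa [mul_assoc, ← pow_succ]))
  obtain ⟨j, hj, hj0⟩ := Submodule.exists_mem_ne_zero_of_ne_bot hJ
  refine h ⟨fun n => Submodule.map (LinearMap.toSpanSingleton R R (a ^ n)) J, fun n hn => ?_,
    iSupIndep_of_antitone_of_disjoint (T := fun n => Ideal.span {a ^ n})
      (antitone_nat_of_succ_le fun n => ?_) (fun n => ?_) fun n => ?_⟩
  · have hmem := Submodule.mem_map_of_mem (f := LinearMap.toSpanSingleton R R (a ^ n)) hj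
    beta_reduce at hn
    rw [hn] at hmem
    exact hj0 (hpow n j (by simpa using hmem))
  · rw [Ideal.span_singleton_le_iff_mem, Ideal.mem_span_singleton']
    exact ⟨a, (pow_succ' a n).symm⟩
  · rintro _ ⟨x, -, rfl⟩
    exact Ideal.mem_span_singleton'.2 ⟨x, rfl⟩
  · rw [Submodule.disjoint_def]
    rintro _ ⟨x, hx, rfl⟩ hmem
    obtain ⟨r, hr⟩ := Ideal.mem_span_singleton'.1 hmem
    have hx' : r * a = x := by
      refine sub_eq_zero.1 (hpow n _ ?_)
      rw [sub_mul, mul_assoc, ← pow_succ', hr]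
      simp
    have hx0 : x ∈ Ideal.span {a} ⊓ J := ⟨Ideal.mem_span_singleton'.2 ⟨r, hx'⟩, hx⟩
    rw [hdisj, Submodule.mem_bot] at hx0
    simp [hx0]

/-- In a semiprime left Goldie ring, an element with zero left annihilator is regular. -/
theorem IsLeftGoldieRing.isRegular {R : Type*} [Ring R] (hsemiprime : IsSemiprimeRing' R)
    (hgoldie : IsLeftGoldieRing R) {a : R} (ha : ∀ x, x * a = 0 → x = 0) : IsRegular a := by
  refine ⟨isLeftRegular_iff_right_eq_zero_of_mul.2 fun x hx => ?_,
    isRightRegular_iff_left_eq_zero_of_mul.2 ha⟩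
  refine eq_zero_of_isEssentialLeftIdeal_torsionOf hsemiprime hgoldie.2
    (isEssentialLeftIdeal_of_exists_mul_mem fun y hy => ?_)
  obtain ⟨r, hr, hr0⟩ :=
    (hgoldie.1.isEssentialLeftIdeal_span_singleton ha).exists_mul_mem hy
  obtain ⟨c, hc⟩ := Ideal.mem_span_singleton'.1 hr
  exact ⟨r, by rw [← hc]; simp [mul_assoc, hx], hr0⟩

/-- In a semiprime ring with a.c.c. on left annihilators, every nonzero left ideal contains
a nonzero element having the same left annihilator as its square. -/
theorem exists_mem_ne_zero_forall_mul_mul_self {R : Type*} [Ring R]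
    (hsemiprime : IsSemiprimeRing' R) (hacc : ACCLeftAnnihilators R) {L : Ideal R}
    (hL : L ≠ ⊥) : ∃ b ∈ L, b ≠ 0 ∧ ∀ x, x * (b * b) = 0 → x * b = 0 := by
  obtain ⟨c, hc, hc0⟩ := Submodule.exists_mem_ne_zero_of_ne_bot hL
  obtain ⟨a, ⟨ha, ha0⟩, hmax⟩ := hacc.exists_maximal_s12 (S := {a | a ∈ L ∧ a ≠ 0}) ⟨c, hc, hc0⟩
  have hr : ∃ r, a * r * a ≠ 0 := by
    by_contra! hr
    exact ha0 (hsemiprime.eq_zero_of_forall_mul_mul_eq_zero hr)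
  obtain ⟨r, hr⟩ := hr
  refine ⟨r * a, L.mul_mem_left r ha, fun h => hr (by rw [mul_assoc, h, mul_zero]),
    fun x hx => ?_⟩
  rw [← mul_assoc]
  refine hmax (a * r * a) ⟨L.mul_mem_left _ ha, hr⟩ (fun y hy => ?_) _ ?_
  · simp [← mul_assoc, hy]
  · simpa only [mul_assoc] using hx

/-- Goldie: every essential left ideal of a semiprime left Goldie ring contains a regular
element. -/
theorem IsEssentialLeftIdeal.exists_isRegular {R : Type*} [Ring R]
    (hsemiprime : IsSemiprimeRing' R) (hgoldie : IsLeftGoldieRing R) {I : Ideal R}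
    (hI : IsEssentialLeftIdeal I) : ∃ a ∈ I, IsRegular a := by
  suffices h : ∃ a ∈ I, ∀ x, x * a = 0 → x = 0 by
    obtain ⟨a, haI, ha⟩ := h
    exact ⟨a, haI, hgoldie.isRegular hsemiprime ha⟩
  by_contra! hcon
  have hstep (s : {s : R // s ∈ I ∧ ∀ x, x * (s * s) = 0 → x * s = 0}) :
      ∃ b ∈ I, b * s = 0 ∧ b ≠ 0 ∧ ∀ x, x * (b * b) = 0 → x * b = 0 := by
    obtain ⟨y, hy, hy0⟩ := hcon s s.2.1
    obtain ⟨b, ⟨hbI, hb⟩, hb0, hbb⟩ := exists_mem_ne_zero_forall_mul_mul_self hsemiprime hgoldie.2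
      (hI (Ideal.torsionOf R R (s : R)) (Submodule.ne_bot_iff _ |>.2 ⟨y, by simpa using hy, hy0⟩))
    exact ⟨b, hbI, by simpa using hb, hb0, hbb⟩
  choose b hbI hbs hb0 hbb using hstep
  have hadd (s) {x : R} (hx : x * (s.1 + b s) = 0) : x * s.1 = 0 ∧ x * b s = 0 := by
    have h1 : x * s.1 = 0 := s.2.2 x <| by
      have := congrArg (· * s.1) hx
      simpa [mul_add, add_mul, mul_assoc, hbs] using this
    exact ⟨h1, by simpa [mul_add, h1] using hx⟩
  let next (s : {s : R // s ∈ I ∧ ∀ x, x * (s * s) = 0 → x * s = 0}) :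
      {s : R // s ∈ I ∧ ∀ x, x * (s * s) = 0 → x * s = 0} :=
    ⟨s.1 + b s, add_mem s.2.1 (hbI s), fun x hx => by
      obtain ⟨h1, h2⟩ := hadd s (x := x * (s.1 + b s)) (by rwa [mul_assoc])
      have h3 : x * s.1 = 0 := s.2.2 x (by simpa [mul_assoc, add_mul, hbs] using h1)
      have h4 : x * b s = 0 := hbb s x (by rwa [mul_add, h3, zero_add, mul_assoc] at h2)
      rw [mul_add, h3, h4, add_zero]⟩
  let S (n : ℕ) := next^[n] ⟨0, I.zero_mem, by simp⟩
  have hS (n : ℕ) : (S (n + 1)).1 = (S n).1 + b (S n) := by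
    simp only [S, Function.iterate_succ_apply']
    rfl
  refine hgoldie.1 ⟨fun n => Ideal.span {b (S n)}, fun n => by simpa using hb0 (S n),
    iSupIndep_of_antitone_of_disjoint (T := fun n => Ideal.torsionOf R R (S n).1)
      (antitone_nat_of_succ_le fun n x hx => ?_) (fun n => ?_) fun n => ?_⟩
  · rw [Ideal.mem_torsionOf_iff, smul_eq_mul, hS] at hx
    exact (hadd _ hx).1
  · rw [Ideal.span_singleton_le_iff_mem]
    exact hbs (S n)
  · rw [Submodule.disjoint_def]
    intro x hx hx'
    obtain ⟨r, rfl⟩ := Ideal.mem_span_singleton'.1 hx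
    rw [Ideal.mem_torsionOf_iff, smul_eq_mul, hS] at hx'
    exact hbb _ r (by simpa only [mul_assoc] using (hadd _ hx').2)

/-- For a subring containing an essential left ideal of a semiprime left Goldie ring, the
regular elements of the subring are exactly its elements that are regular in the ring. -/
theorem Subring.isRegular_coe_iff_of_large {R : Type*} [Ring R]
    (hsemiprime : IsSemiprimeRing' R) (hgoldie : IsLeftGoldieRing R) {R' : Subring R}
    (hlarge : ∃ I : Ideal R, IsEssentialLeftIdeal I ∧ (I : Set R) ⊆ (R' : Set R)) (x : R') :
    IsRegular (x : R) ↔ IsRegular x := by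
  refine ⟨fun hx => ⟨fun y z hyz => Subtype.ext (hx.left (congrArg Subtype.val hyz)),
    fun y z hyz => Subtype.ext (hx.right (congrArg Subtype.val hyz))⟩, fun hx => ?_⟩
  obtain ⟨I, hI, hIR⟩ := hlarge
  refine hgoldie.isRegular hsemiprime fun r hr => ?_
  by_contra hr0
  obtain ⟨y, hy, hy0⟩ := hI.exists_mul_mem hr0
  have h := isRightRegular_iff_left_eq_zero_of_mul.1 hx.right ⟨y * r, hIR hy⟩
    (Subtype.ext (by simp [mul_assoc, hr]))
  exact hy0 (congrArg Subtype.val h)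

/-- **Theorem 2.4.(4).** If `R'` is a subring of a semiprime left Goldie ring `R`
containing an essential left ideal of `R`, and `θ : R →+* Q` realizes the classical left
quotient ring `Q = Q_l(R) = C_R⁻¹R`, then the classical left quotient ring of `R'`
exists and `Q_l(R') = C_{R'}⁻¹R' = C_{R'}⁻¹R = Q_l(R)`:  the restriction of `θ` to `R'`
realizes `Q` as `C_{R'}⁻¹R' = Q_l(R')`, and `θ` realizes `Q` as `C_{R'}⁻¹R`. -/
theorem classical_quotient_ring_of_large_subring {R : Type u} {Q : Type v}
    [Ring R] [Ring Q]
    (hsemiprime : IsSemiprimeRing' R) (hgoldie : IsLeftGoldieRing R)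
    (R' : Subring R)
    (hlarge : ∃ I : Ideal R, IsEssentialLeftIdeal I ∧ (I : Set R) ⊆ (R' : Set R))
    (θ : R →+* Q) (hloc : IsLeftLocalization {r : R | IsRegular r} θ) :
    ∃ θ' : R' →+* Q, (∀ x : R', θ' x = θ (x : R)) ∧
      IsLeftLocalization {x : R' | IsRegular x} θ' ∧
      IsLeftLocalization {r : R | ∃ h : r ∈ R', IsRegular (⟨r, h⟩ : R')} θ := by
  have hreg := Subring.isRegular_coe_iff_of_large hsemiprime hgoldie hlarge
  have hinj (r : R) (hr : θ r = 0) : r = 0 := by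
    obtain ⟨s, hs, hsr⟩ := (hloc.ker_eq r).1 hr
    exact isLeftRegular_iff_right_eq_zero_of_mul.1 hs.left r hsr
  have hrep (q : Q) : ∃ s r : R', IsRegular s ∧ θ s * q = θ r := by
    obtain ⟨I, hI, hIR⟩ := hlarge
    obtain ⟨c, hcI, hc⟩ := hI.exists_isRegular hsemiprime hgoldie
    obtain ⟨u, hu⟩ := hloc.isUnit c hc
    obtain ⟨a, ha, d, hd⟩ := hloc.exists_rep (θ c * q * ↑u⁻¹)
    refine ⟨⟨a * c, hIR (I.mul_mem_left a hcI)⟩, ⟨d * c, hIR (I.mul_mem_left d hcI)⟩,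
      (hreg _).1 (ha.mul hc), ?_⟩
    simp only [map_mul, ← hd, ← hu]
    simp [mul_assoc]
  refine ⟨θ.comp R'.subtype, fun _ => rfl, ⟨fun s hs => hloc.isUnit s ((hreg s).2 hs),
    fun r => ⟨fun hr => ⟨1, isRegular_one, ?_⟩, ?_⟩, fun q => ?_⟩,
    ⟨?_, fun r => ⟨fun hr => ⟨1, ⟨R'.one_mem, isRegular_one⟩, ?_⟩, ?_⟩, fun q => ?_⟩⟩
  · exact Subtype.ext (by simpa using hinj r hr)
  · rintro ⟨s, hs, hsr⟩
    have h0 : (r : R) = 0 := isLeftRegular_iff_right_eq_zero_of_mul.1 ((hreg s).2 hs).left _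
      (congrArg Subtype.val hsr)
    simp [h0]
  · obtain ⟨s, r, hs, h⟩ := hrep q
    exact ⟨s, hs, r, h⟩
  · rintro s ⟨hs, hs'⟩
    exact hloc.isUnit s ((hreg ⟨s, hs⟩).2 hs')
  · simp [hinj r hr]
  · rintro ⟨s, ⟨hs, hs'⟩, hsr⟩
    exact (hloc.ker_eq r).2 ⟨s, (hreg ⟨s, hs⟩).2 hs', hsr⟩
  · obtain ⟨s, r, hs, h⟩ := hrep q
    exact ⟨s, ⟨s.2, hs⟩, r, h⟩
end
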